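/- arXiv:2110.00629 — 2 statements merged into one kernel-verified Lean document; each statement's English description precedes it below -/
import Mathlib

section
/- Assume the cost tensor C has nonnegative entries. Then MMOT-DC_ε((T_m)_{m=1}^M, μ) → F-MMOT((T_m)_{m=1}^M, μ) as ε → ∞. -/
open scoped BigOperators

namespace MMOTPaper

variable {N M : ℕ}

/-- Frobenius inner product of two tensors. -/
def inner' {ι : Type*} [Fintype ι] (C P : ι → ℝ) : ℝ := ∑ x, C x * P x

/-- A probability tensor: nonnegative entries summing to 1. -/
def IsProb {ι : Type*} [Fintype ι] (P : ι → ℝ) : Prop :=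
  (∀ x, 0 ≤ P x) ∧ ∑ x, P x = 1

/-- Negative entropy `H(P) = ∑ P log P`. -/
noncomputable def negEnt {ι : Type*} [Fintype ι] (P : ι → ℝ) : ℝ :=
  ∑ x, P x * Real.log (P x)

/-- Kullback-Leibler divergence; `⊤` if `μ` is not absolutely continuous w.r.t. `ν`. -/
noncomputable def KL {ι : Type*} [Fintype ι] (μ ν : ι → ℝ) : EReal :=
  if ∀ x, ν x = 0 → μ x = 0 then ((∑ x, μ x * Real.log (μ x / ν x) : ℝ) : EReal)
  else ⊤

/-- `n`-th marginal vector of a tensor. -/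
def marg1 (a : Fin N → ℕ) (P : ((n : Fin N) → Fin (a n)) → ℝ) (n : Fin N)
    (i : Fin (a n)) : ℝ :=
  ∑ x : (n : Fin N) → Fin (a n), if x n = i then P x else 0

/-- The set `U_T` of admissible couplings: probability tensors with marginals `μ n`. -/
def UT (a : Fin N → ℕ) (μ : (n : Fin N) → Fin (a n) → ℝ) :
    Set (((n : Fin N) → Fin (a n)) → ℝ) :=
  {P | IsProb P ∧ ∀ n i, marg1 a P n i = μ n i}

/-- A tuple partition of `(1,…,N)` into `M` blocks, encoded by the block assignment map:
monotonicity says the blocks are tuples of consecutive indices concatenating to `T`,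
surjectivity says each block is nonempty. -/
def IsPartition (part : Fin N → Fin M) : Prop :=
  Monotone part ∧ Function.Surjective part

/-- Restriction of a full index to the coordinates of block `m`. -/
def restr (a : Fin N → ℕ) (part : Fin N → Fin M) (m : Fin M)
    (x : (n : Fin N) → Fin (a n)) : (n : {n : Fin N // part n = m}) → Fin (a n.1) :=
  fun n => x n.1

/-- The `T_m`-marginal tensor `P_{#m}` of `P`: sum over all dimensions not in block `m`. -/
def margBlock (a : Fin N → ℕ) (part : Fin N → Fin M) (m : Fin M)
    (P : ((n : Fin N) → Fin (a n)) → ℝ)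
    (y : (n : {n : Fin N // part n = m}) → Fin (a n.1)) : ℝ :=
  ∑ x : (n : Fin N) → Fin (a n), if restr a part m x = y then P x else 0

/-- Tensor product of block tensors. -/
def tprod (a : Fin N → ℕ) (part : Fin N → Fin M)
    (Q : (m : Fin M) → ((n : {n : Fin N // part n = m}) → Fin (a n.1)) → ℝ)
    (x : (n : Fin N) → Fin (a n)) : ℝ :=
  ∏ m, Q m (restr a part m x)

/-- `P_{#T}`: the tensor product of the block marginals of `P`. -/
def prodMarg (a : Fin N → ℕ) (part : Fin N → Fin M)
    (P : ((n : Fin N) → Fin (a n)) → ℝ) : ((n : Fin N) → Fin (a n)) → ℝ :=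
  tprod a part (fun m => margBlock a part m P)

/-- The product tensor `μ_1 ⊗ … ⊗ μ_N`. -/
def prodMu (a : Fin N → ℕ) (μ : (n : Fin N) → Fin (a n) → ℝ)
    (x : (n : Fin N) → Fin (a n)) : ℝ :=
  ∏ n, μ n (x n)

/-- The set `F_M` of admissible couplings factorizing as a tensor product
of probability tensors indexed by the blocks. -/
def FM (a : Fin N → ℕ) (μ : (n : Fin N) → Fin (a n) → ℝ) (part : Fin N → Fin M) :
    Set (((n : Fin N) → Fin (a n)) → ℝ) :=
  {P | P ∈ UT a μ ∧
    ∃ Q : (m : Fin M) → ((n : {n : Fin N // part n = m}) → Fin (a n.1)) → ℝ,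
      (∀ m, IsProb (Q m)) ∧ P = tprod a part Q}

/-- The MMOT value `inf_{P ∈ U_T} ⟨C, P⟩`. -/
noncomputable def MMOTval (a : Fin N → ℕ) (μ : (n : Fin N) → Fin (a n) → ℝ)
    (C : ((n : Fin N) → Fin (a n)) → ℝ) : ℝ :=
  sInf ((fun P => inner' C P) '' UT a μ)

/-- The F-MMOT value `inf_{P ∈ F_M} ⟨C, P⟩`. -/
noncomputable def FMMOTval (a : Fin N → ℕ) (μ : (n : Fin N) → Fin (a n) → ℝ)
    (part : Fin N → Fin M) (C : ((n : Fin N) → Fin (a n)) → ℝ) : ℝ :=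
  sInf ((fun P => inner' C P) '' FM a μ part)

/-- The MMOT-DC objective `⟨C, P⟩ + ε KL(P | P_{#T})`. -/
noncomputable def dcObj (a : Fin N → ℕ) (part : Fin N → Fin M)
    (C : ((n : Fin N) → Fin (a n)) → ℝ) (ε : ℝ)
    (P : ((n : Fin N) → Fin (a n)) → ℝ) : EReal :=
  ((inner' C P : ℝ) : EReal) + (ε : EReal) * KL P (prodMarg a part P)

/-- The MMOT-DC value `inf_{P ∈ U_T} ⟨C, P⟩ + ε KL(P | P_{#T})`. -/
noncomputable def MMOTDCval (a : Fin N → ℕ) (μ : (n : Fin N) → Fin (a n) → ℝ)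
    (part : Fin N → Fin M) (C : ((n : Fin N) → Fin (a n)) → ℝ) (ε : ℝ) : EReal :=
  ⨅ P ∈ UT a μ, dcObj a part C ε P

lemma tprod_sum (a : Fin N → ℕ) (part : Fin N → Fin M)
    (Q : (m : Fin M) → ((n : {n : Fin N // part n = m}) → Fin (a n.1)) → ℝ) :
    ∑ x, tprod a part Q x = ∏ m, ∑ y, Q m y := by
  classical
  let e : ((n : Fin N) → Fin (a n)) ≃
      ((m : Fin M) → (n : {n : Fin N // part n = m}) → Fin (a n.1)) :=
    { toFun := fun x m => restr a part m x
      invFun := fun y n => y (part n) ⟨n, rfl⟩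
      left_inv := fun x => rfl
      right_inv := fun y => by
        funext m ⟨n, hn⟩
        subst hn
        rfl }
  rw [Fintype.prod_sum]
  exact Fintype.sum_equiv e _ _ (fun x => rfl)

lemma tprod_sum_weight (a : Fin N → ℕ) (part : Fin N → Fin M)
    (Q : (m : Fin M) → ((n : {n : Fin N // part n = m}) → Fin (a n.1)) → ℝ)
    (hQ : ∀ m, ∑ y, Q m y = 1) (k : Fin M)
    (g : ((n : {n : Fin N // part n = k}) → Fin (a n.1)) → ℝ) :
    ∑ x, g (restr a part k x) * tprod a part Q x = ∑ y, g y * Q k y := by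
  classical
  have h := tprod_sum a part (Function.update Q k (fun y => g y * Q k y))
  have h1 : ∀ x, tprod a part (Function.update Q k (fun y => g y * Q k y)) x =
      g (restr a part k x) * tprod a part Q x := by
    intro x
    unfold tprod
    rw [← Finset.mul_prod_erase _ _ (Finset.mem_univ k),
      ← Finset.mul_prod_erase (f := fun m => Q m (restr a part m x)) _ (Finset.mem_univ k),
      Function.update_self, mul_assoc]
    congr 2
    refine Finset.prod_congr rfl fun m hm => ?_
    rw [Function.update_of_ne (Finset.ne_of_mem_erase hm)]
  simp_rw [h1] at h
  rw [h, ← Finset.mul_prod_erase _ _ (Finset.mem_univ k), Function.update_self,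
    Finset.prod_eq_one, mul_one]
  intro m hm
  rw [Function.update_of_ne (Finset.ne_of_mem_erase hm), hQ]

lemma margBlock_sum_weight (a : Fin N → ℕ) (part : Fin N → Fin M) (k : Fin M)
    (P : ((n : Fin N) → Fin (a n)) → ℝ)
    (g : ((n : {n : Fin N // part n = k}) → Fin (a n.1)) → ℝ) :
    ∑ y, g y * margBlock a part k P y = ∑ x, g (restr a part k x) * P x := by
  unfold margBlock
  simp_rw [Finset.mul_sum]
  rw [Finset.sum_comm]
  refine Finset.sum_congr rfl fun x _ => ?_
  simp

lemma margBlock_tprod (a : Fin N → ℕ) (part : Fin N → Fin M)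
    (Q : (m : Fin M) → ((n : {n : Fin N // part n = m}) → Fin (a n.1)) → ℝ)
    (hQ : ∀ m, ∑ y, Q m y = 1) (k : Fin M) :
    margBlock a part k (tprod a part Q) = Q k := by
  funext y
  have := tprod_sum_weight a part Q hQ k (fun z => if z = y then 1 else 0)
  simpa [margBlock] using this

lemma margBlock_isProb (a : Fin N → ℕ) (part : Fin N → Fin M)
    (P : ((n : Fin N) → Fin (a n)) → ℝ) (hP : IsProb P) (k : Fin M) :
    IsProb (margBlock a part k P) := by
  refine ⟨fun y => Finset.sum_nonneg fun x _ => ?_, ?_⟩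
  · split_ifs
    · exact hP.1 x
    · exact le_rfl
  · have := margBlock_sum_weight a part k P (fun _ => 1)
    simpa [hP.2] using this

lemma prodMarg_mem_FM (a : Fin N → ℕ) (μ : (n : Fin N) → Fin (a n) → ℝ)
    (part : Fin N → Fin M) (P : ((n : Fin N) → Fin (a n)) → ℝ) (hP : P ∈ UT a μ) :
    prodMarg a part P ∈ FM a μ part := by
  have hb := margBlock_isProb a part P hP.1
  refine ⟨⟨⟨fun x => ?_, ?_⟩, fun n i => ?_⟩, _, hb, rfl⟩
  · unfold prodMarg tprod
    exact Finset.prod_nonneg fun m _ => (hb m).1 _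
  · unfold prodMarg
    rw [tprod_sum]
    exact Finset.prod_eq_one fun m _ => (hb m).2
  · rw [← hP.2 n i]
    have h1 := tprod_sum_weight a part (fun m => margBlock a part m P) (fun m => (hb m).2)
      (part n) (fun y => if y ⟨n, rfl⟩ = i then 1 else 0)
    rw [margBlock_sum_weight] at h1
    have key : ∀ R : ((n : Fin N) → Fin (a n)) → ℝ, marg1 a R n i =
        ∑ x, (fun y : (k : {k : Fin N // part k = part n}) → Fin (a k.1) =>
          if y ⟨n, rfl⟩ = i then (1 : ℝ) else 0) (restr a part (part n) x) * R x := by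
      intro R
      unfold marg1
      refine Finset.sum_congr rfl fun x _ => ?_
      change _ = (if x n = i then (1 : ℝ) else 0) * R x
      split_ifs <;> simp
    rw [key, key]
    exact h1

lemma prodMu_mem_UT (a : Fin N → ℕ) (μ : (n : Fin N) → Fin (a n) → ℝ)
    (hμ : ∀ n, IsProb (μ n)) : prodMu a μ ∈ UT a μ := by
  classical
  refine ⟨⟨fun x => Finset.prod_nonneg fun n _ => (hμ n).1 _, ?_⟩, fun n i => ?_⟩
  · unfold prodMu
    rw [← Fintype.prod_sum]
    exact Finset.prod_eq_one fun m _ => (hμ m).2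
  · have h := Fintype.prod_sum (Function.update μ n (fun j => if j = i then μ n j else 0))
    rw [← Finset.mul_prod_erase _ _ (Finset.mem_univ n), Function.update_self,
      Finset.prod_eq_one, mul_one] at h
    · simp only [Finset.sum_ite_eq', Finset.mem_univ, if_true] at h
      rw [h]
      unfold marg1 prodMu
      refine Finset.sum_congr rfl fun x _ => ?_
      rw [← Finset.mul_prod_erase _ _ (Finset.mem_univ n),
        ← Finset.mul_prod_erase
          (f := fun k => Function.update μ n (fun j => if j = i then μ n j else 0) k (x k))
          _ (Finset.mem_univ n), Function.update_self, ← ite_zero_mul]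
      congr 1
      refine Finset.prod_congr rfl fun m hm => ?_
      rw [Function.update_of_ne (Finset.ne_of_mem_erase hm)]
    · intro m hm
      rw [Function.update_of_ne (Finset.ne_of_mem_erase hm), (hμ m).2]

lemma log_bound (p r : ℝ) (hp : 0 ≤ p) (hr : 0 ≤ r) (h : r = 0 → p = 0) :
    2 * p - 2 * (√p * √r) ≤ p * Real.log (p / r) := by
  rcases hp.eq_or_lt with rfl | hp'
  · simp
  have hr' : 0 < r := lt_of_le_of_ne hr fun h0 => hp'.ne' (h h0.symm)
  have h1 := Real.log_le_sub_one_of_pos (div_pos (Real.sqrt_pos.2 hr') (Real.sqrt_pos.2 hp'))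
  rw [Real.log_div (Real.sqrt_pos.2 hr').ne' (Real.sqrt_pos.2 hp').ne',
    Real.log_sqrt hr, Real.log_sqrt hp] at h1
  rw [Real.log_div hp'.ne' hr'.ne']
  have h2 := mul_le_mul_of_nonneg_left h1 hp
  have h3 : p * (√r / √p - 1) = √p * √r - p := by
    have hs := (Real.sqrt_pos.2 hp').ne'
    have := Real.mul_self_sqrt hp
    field_simp
    linear_combination (-√r) * this
  nlinarith

lemma point_bound (c ε p r : ℝ) (hε : 0 < ε) (hp : 0 ≤ p) (hr : 0 ≤ r)
    (hp1 : p ≤ 1) (hr1 : r ≤ 1) (h : r = 0 → p = 0) :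
    c * r - c ^ 2 / ε + ε * (p - r) ≤ c * p + ε * (p * Real.log (p / r)) := by
  have h1 := mul_le_mul_of_nonneg_left (log_bound p r hp hr h) hε.le
  have hps := Real.mul_self_sqrt hp
  have hrs := Real.mul_self_sqrt hr
  have a1 := Real.sqrt_le_one.2 hp1
  have a2 := Real.sqrt_le_one.2 hr1
  have b1 := Real.sqrt_nonneg p
  have b2 := Real.sqrt_nonneg r
  set s := √p
  set t := √r
  -- need: 0 ≤ c (p-r) + c²/ε + ε (s-t)²
  have h2 : 0 ≤ c * (p - r) + c ^ 2 / ε + ε * (s - t) ^ 2 := by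
    have e1 : c * (p - r) + c ^ 2 / ε + ε * (s - t) ^ 2
        = (c * ((s + t) / 2) + ε * (s - t)) ^ 2 / ε
          + c ^ 2 / ε * (1 - ((s + t) / 2) ^ 2) := by
      rw [← hps, ← hrs]
      field_simp
      ring
    rw [e1]
    have : ((s + t) / 2) ^ 2 ≤ 1 := by nlinarith
    have : 0 ≤ 1 - ((s + t) / 2) ^ 2 := by linarith
    positivity
  nlinarith

lemma IsProb.le_one {ι : Type*} [Fintype ι] {P : ι → ℝ} (h : IsProb P) (x : ι) : P x ≤ 1 := by
  rw [← h.2]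
  exact Finset.single_le_sum (fun y _ => h.1 y) (Finset.mem_univ x)

/-- If `C` has nonnegative entries then
`MMOT-DC_ε((T_m), μ) → F-MMOT((T_m), μ)` as `ε → ∞`. -/
theorem mmotdc_tendsto_fmmot {N M : ℕ} (hN : 0 < N) (hM : 0 < M)
    (a : Fin N → ℕ) (ha : ∀ n, 0 < a n)
    (μ : (n : Fin N) → Fin (a n) → ℝ) (hμ : ∀ n, IsProb (μ n))
    (part : Fin N → Fin M) (hpart : IsPartition part)
    (C : ((n : Fin N) → Fin (a n)) → ℝ) (hC : ∀ x, 0 ≤ C x) :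
    Filter.Tendsto (fun ε : ℝ => MMOTDCval a μ part C ε)
      Filter.atTop (nhds ((FMMOTval a μ part C : ℝ) : EReal)) := by
  have hFne : (FM a μ part).Nonempty := ⟨_, prodMarg_mem_FM a μ part _ (prodMu_mem_UT a μ hμ)⟩
  have hbdd : BddBelow ((fun P => inner' C P) '' FM a μ part) := by
    refine ⟨0, ?_⟩
    rintro _ ⟨P, hP, rfl⟩
    exact Finset.sum_nonneg fun x _ => mul_nonneg (hC x) (hP.1.1.1 x)
  -- upper bound
  have hup : ∀ ε : ℝ, MMOTDCval a μ part C ε ≤ ((FMMOTval a μ part C : ℝ) : EReal) := by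
    intro ε
    have h1 : ∀ P ∈ FM a μ part, MMOTDCval a μ part C ε ≤ ((inner' C P : ℝ) : EReal) := by
      rintro P ⟨hPU, Q, hQ, hPQ⟩
      refine (iInf₂_le P hPU).trans ?_
      have hself : prodMarg a part P = P := by
        have : (fun m => margBlock a part m P) = Q := by
          funext m
          rw [hPQ, margBlock_tprod a part Q (fun m => (hQ m).2)]
        unfold prodMarg
        rw [this, hPQ]
      have hKL : KL P P = 0 := by
        unfold KL
        rw [if_pos (fun x h => h)]
        rw [Finset.sum_eq_zero]
        · simp
        · intro x _
          by_cases h : P x = 0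
          · simp [h]
          · simp [div_self h]
      unfold dcObj
      rw [hself, hKL, mul_zero, add_zero]
    refine le_of_forall_gt fun c hc => ?_
    obtain ⟨d, hd1, hd2⟩ := EReal.lt_iff_exists_real_btwn.1 hc
    obtain ⟨_, ⟨P, hP, rfl⟩, hlt⟩ :=
      exists_lt_of_csInf_lt (hFne.image _) (EReal.coe_lt_coe_iff.1 hd1)
    exact ((h1 P hP).trans_lt (EReal.coe_lt_coe_iff.2 hlt)).trans hd2
  -- lower bound
  have hlow : ∀ ε : ℝ, 0 < ε →
      ((FMMOTval a μ part C - (∑ x, C x ^ 2) / ε : ℝ) : EReal) ≤ MMOTDCval a μ part C ε := by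
    intro ε hε
    refine le_iInf₂ fun P hP => ?_
    have hR := prodMarg_mem_FM a μ part P hP
    unfold dcObj KL
    split_ifs with hac
    · rw [← EReal.coe_mul, ← EReal.coe_add, EReal.coe_le_coe_iff]
      have hF : FMMOTval a μ part C ≤ inner' C (prodMarg a part P) :=
        csInf_le hbdd ⟨_, hR, rfl⟩
      have hs := Finset.sum_le_sum fun x (_ : x ∈ Finset.univ) =>
        point_bound (C x) ε (P x) (prodMarg a part P x) hε (hP.1.1 x) (hR.1.1.1 x)
          (hP.1.le_one x) (hR.1.1.le_one x) (hac x)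
      simp only [Finset.sum_add_distrib, Finset.sum_sub_distrib, ← Finset.mul_sum,
        ← Finset.sum_div, hP.1.2, hR.1.1.2] at hs
      unfold inner' at hF ⊢
      linarith
    · rw [EReal.coe_mul_top_of_pos hε, EReal.coe_add_top]
      exact le_top
  have hlim : Filter.Tendsto
      (fun ε : ℝ => ((FMMOTval a μ part C - (∑ x, C x ^ 2) / ε : ℝ) : EReal))
      Filter.atTop (nhds ((FMMOTval a μ part C : ℝ) : EReal)) := by
    refine (continuous_coe_real_ereal.tendsto _).comp ?_
    have := (tendsto_const_nhds (x := FMMOTval a μ part C)).sub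
      ((tendsto_const_nhds (x := ∑ x, C x ^ 2)).div_atTop
        (Filter.tendsto_id (α := ℝ) (x := Filter.atTop)))
    simpa using this
  refine tendsto_of_tendsto_of_tendsto_of_le_of_le' hlim tendsto_const_nhds ?_
    (Filter.Eventually.of_forall hup)
  filter_upwards [Filter.eventually_gt_atTop 0] with ε hε
  exact hlow ε hε

end MMOTPaper
end

section
/- Let (ε_k)_k be a sequence of positive reals with ε_k → 0, and for each k let P_{ε_k} be a minimizer of MMOT-DC_{ε_k}((T_m)_{m=1}^M, μ). If P_{ε_k} converges to some tensor P̃, then P̃ is a minimizer of MMOT(μ). -/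
open scoped BigOperators

namespace MMOTPaper

variable {N M : ℕ}

theorem margBlock_bounds {N M : ℕ} (a : Fin N → ℕ) (part : Fin N → Fin M) (m : Fin M)
    (P : ((n : Fin N) → Fin (a n)) → ℝ) (hP : IsProb P)
    (y : (n : {n : Fin N // part n = m}) → Fin (a n.1)) :
    0 ≤ margBlock a part m P y ∧ margBlock a part m P y ≤ 1 := by
  constructor
  · apply Finset.sum_nonneg
    intro x _
    split_ifs
    · exact hP.1 x
    · exact le_rfl
  · rw [← hP.2]
    apply Finset.sum_le_sum
    intro x _
    split_ifs
    · exact le_rfl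
    · exact hP.1 x

theorem le_margBlock {N M : ℕ} (a : Fin N → ℕ) (part : Fin N → Fin M) (m : Fin M)
    (P : ((n : Fin N) → Fin (a n)) → ℝ) (hP : IsProb P) (x : (n : Fin N) → Fin (a n)) :
    P x ≤ margBlock a part m P (restr a part m x) := by
  have h := Finset.single_le_sum
    (f := fun x' => if restr a part m x' = restr a part m x then P x' else 0)
    (s := Finset.univ) (fun i _ => by
      split_ifs
      · exact hP.1 i
      · exact le_rfl) (Finset.mem_univ x)
  simpa [margBlock] using h

theorem prodMarg_ac {N M : ℕ} (a : Fin N → ℕ) (part : Fin N → Fin M)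
    (P : ((n : Fin N) → Fin (a n)) → ℝ) (hP : IsProb P) (x : (n : Fin N) → Fin (a n))
    (h : prodMarg a part P x = 0) : P x = 0 := by
  unfold prodMarg tprod at h
  obtain ⟨m, _, hm⟩ := Finset.prod_eq_zero_iff.1 h
  have := le_margBlock a part m P hP x
  have h0 := hP.1 x
  linarith

theorem prodMarg_bounds {N M : ℕ} (a : Fin N → ℕ) (part : Fin N → Fin M)
    (P : ((n : Fin N) → Fin (a n)) → ℝ) (hP : IsProb P) (x : (n : Fin N) → Fin (a n)) :
    0 ≤ prodMarg a part P x ∧ prodMarg a part P x ≤ 1 := by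
  unfold prodMarg tprod
  exact ⟨Finset.prod_nonneg fun m _ => (margBlock_bounds a part m P hP _).1,
   Finset.prod_le_one (fun m _ => (margBlock_bounds a part m P hP _).1)
    fun m _ => (margBlock_bounds a part m P hP _).2⟩

/-- The real value of the KL term. -/
noncomputable def klReal {ι : Type*} [Fintype ι] (p q : ι → ℝ) : ℝ :=
  ∑ x, p x * Real.log (p x / q x)

theorem dcObj_eq {N M : ℕ} (a : Fin N → ℕ) (part : Fin N → Fin M)
    (C P : ((n : Fin N) → Fin (a n)) → ℝ) (e : ℝ) (hP : IsProb P) :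
    dcObj a part C e P = ((inner' C P + e * klReal P (prodMarg a part P) : ℝ) : EReal) := by
  unfold dcObj KL klReal
  rw [if_pos (fun x hx => prodMarg_ac a part P hP x hx)]
  push_cast
  rfl

theorem klReal_lower {N M : ℕ} (a : Fin N → ℕ) (part : Fin N → Fin M)
    (P : ((n : Fin N) → Fin (a n)) → ℝ) (hP : IsProb P) :
    -(Fintype.card ((n : Fin N) → Fin (a n)) : ℝ) ≤ klReal P (prodMarg a part P) := by
  have h : ∑ _x : ((n : Fin N) → Fin (a n)), (-1 : ℝ) ≤ klReal P (prodMarg a part P) := by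
    apply Finset.sum_le_sum
    intro x _
    obtain ⟨h0, h1⟩ := prodMarg_bounds a part P hP x
    rcases (hP.1 x).eq_or_lt with hz | hz
    · rw [← hz]; simp
    · have hq : 0 < prodMarg a part P x :=
        lt_of_le_of_ne h0 fun h => hz.ne' (prodMarg_ac a part P hP x h.symm)
      have hl := Real.one_sub_inv_le_log_of_pos (div_pos hz hq)
      have h2 := mul_le_mul_of_nonneg_left hl hz.le
      have h3 : P x * (1 - (P x / prodMarg a part P x)⁻¹) = P x - prodMarg a part P x := by
        field_simp
      linarith
  simpa using h

/-- If `ε_k > 0`, `ε_k → 0`, each `P k` is a minimizer of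
`MMOT-DC_{ε_k}` and `P k → P̃`, then `P̃` is a minimizer of `MMOT(μ)`. -/
theorem cluster_point_minimizes_mmot {N M : ℕ} (hN : 0 < N) (hM : 0 < M)
    (a : Fin N → ℕ) (ha : ∀ n, 0 < a n)
    (μ : (n : Fin N) → Fin (a n) → ℝ) (hμ : ∀ n, IsProb (μ n))
    (part : Fin N → Fin M) (hpart : IsPartition part)
    (C : ((n : Fin N) → Fin (a n)) → ℝ)
    (ε : ℕ → ℝ) (hεpos : ∀ k, 0 < ε k)
    (hε : Filter.Tendsto ε Filter.atTop (nhds 0))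
    (P : ℕ → ((n : Fin N) → Fin (a n)) → ℝ)
    (hPmem : ∀ k, P k ∈ UT a μ)
    (hPmin : ∀ k, ∀ Q ∈ UT a μ, dcObj a part C (ε k) (P k) ≤ dcObj a part C (ε k) Q)
    (Pt : ((n : Fin N) → Fin (a n)) → ℝ)
    (hlim : Filter.Tendsto P Filter.atTop (nhds Pt)) :
    Pt ∈ UT a μ ∧ ∀ Q ∈ UT a μ, inner' C Pt ≤ inner' C Q := by
  have hpt : ∀ x, Filter.Tendsto (fun k => P k x) Filter.atTop (nhds (Pt x)) :=
    tendsto_pi_nhds.1 hlim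
  refine ⟨⟨⟨fun x => ge_of_tendsto' (hpt x) fun k => (hPmem k).1.1 x, ?_⟩, ?_⟩, ?_⟩
  · have h := tendsto_finsetSum Finset.univ fun x _ => hpt x
    refine tendsto_nhds_unique h ?_
    simp only [(hPmem _).1.2]
    exact tendsto_const_nhds
  · intro n i
    have h : Filter.Tendsto (fun k => marg1 a (P k) n i) Filter.atTop
        (nhds (marg1 a Pt n i)) := by
      unfold marg1
      refine tendsto_finsetSum Finset.univ fun x _ => ?_
      split_ifs
      · exact hpt x
      · exact tendsto_const_nhds
    refine tendsto_nhds_unique h ?_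
    simp only [(hPmem _).2]
    exact tendsto_const_nhds
  · intro Q hQ
    have hC : Filter.Tendsto (fun k => inner' C (P k)) Filter.atTop (nhds (inner' C Pt)) :=
      tendsto_finsetSum Finset.univ fun x _ => (hpt x).const_mul _
    have hR : Filter.Tendsto (fun k => inner' C Q + ε k * (klReal Q (prodMarg a part Q) +
        Fintype.card ((n : Fin N) → Fin (a n)))) Filter.atTop (nhds (inner' C Q)) := by
      simpa using (hε.mul_const (klReal Q (prodMarg a part Q) +
        Fintype.card ((n : Fin N) → Fin (a n)))).const_add (inner' C Q)
    refine le_of_tendsto_of_tendsto' hC hR fun k => ?_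
    have h := hPmin k Q hQ
    rw [dcObj_eq a part C _ _ (hPmem k).1, dcObj_eq a part C _ _ hQ.1,
      EReal.coe_le_coe_iff] at h
    have h2 := mul_le_mul_of_nonneg_left (klReal_lower a part (P k) (hPmem k).1) (hεpos k).le
    linarith

end MMOTPaper
end
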